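/- arXiv:2312.06304 — 3 statements merged into one kernel-verified Lean document; each statement's English description precedes it below -/
import Mathlib

section
/- Let L be a fixed 4×4 real symmetric positive definite matrix, let L̂ : ℝ → Matrix(4,4,ℝ) be a matrix-valued function, and let t ∈ ℝ be such that L̂ has derivative L̂′(t) at t (entrywise, i.e. HasDerivAt) and L̂(t) is symmetric positive definite. Then the function s ↦ log(det L̂(s) / det L) + tr(L̂(s)⁻¹ · L) − 4 has derivative at t equal to tr( (L̂(t)⁻¹ · L̂′(t) · L̂(t)⁻¹) · (L̂(t) − L) ). -/
open Matrix

namespace Matrix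

variable {n : Type*} [Fintype n] [DecidableEq n]

/-- **Jacobi's formula** for the derivative of a determinant along a curve of matrices. -/
theorem hasDerivAt_det {A : ℝ → Matrix n n ℝ} {A' : Matrix n n ℝ} {t : ℝ}
    (hA : ∀ i j, HasDerivAt (fun s => A s i j) (A' i j) t) :
    HasDerivAt (fun s => (A s).det) ((adjugate (A t) * A').trace) t := by
  have hdet : HasDerivAt (fun s => (A s).det)
      (∑ σ : Equiv.Perm n, ((Equiv.Perm.sign σ : ℤ) : ℝ) *
        ∑ i, (∏ j ∈ Finset.univ.erase i, A t (σ j) j) • A' (σ i) i) t := by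
    simp only [det_apply']
    exact HasDerivAt.fun_sum fun σ _ =>
      (HasDerivAt.fun_finsetProd fun i _ => hA (σ i) i).const_mul _
  convert hdet using 1
  have hcol (i : n) : (adjugate (A t) * A') i i = ((A t).updateCol i fun k => A' k i).det := by
    rw [← cramer_apply, cramer_eq_adjugate_mulVec]
    rfl
  simp only [trace, diag_apply, hcol, det_apply', Finset.mul_sum]
  rw [Finset.sum_comm]
  refine Finset.sum_congr rfl fun σ _ => Finset.sum_congr rfl fun i _ => ?_
  rw [← Finset.prod_erase_mul _ _ (Finset.mem_univ i), updateCol_self, smul_eq_mul]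
  congr 2
  exact Finset.prod_congr rfl fun j hj => updateCol_ne (Finset.ne_of_mem_erase hj)

open scoped Matrix.Norms.Operator in
/-- The derivative of the inverse along a curve of matrices, entrywise. -/
theorem hasDerivAt_inv_apply {A : ℝ → Matrix n n ℝ} {A' : Matrix n n ℝ} {t : ℝ}
    (hA : ∀ i j, HasDerivAt (fun s => A s i j) (A' i j) t) (ht : IsUnit (A t)) (i j : n) :
    HasDerivAt (fun s => (A s)⁻¹ i j) ((-((A t)⁻¹ * A' * (A t)⁻¹)) i j) t := by
  have hA_matrix : HasDerivAt A A' t :=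
    hasDerivAt_pi.2 fun i => hasDerivAt_pi.2 (hA i)
  obtain ⟨u, hu⟩ := ht
  have hinv := hasFDerivAt_ringInverse (𝕜 := ℝ) u
  rw [hu] at hinv
  have h := hinv.comp_hasDerivAt t hA_matrix
  have h_entry := hasDerivAt_pi.1 (hasDerivAt_pi.1 h i) j
  simpa [Function.comp_def, ← nonsing_inv_eq_ringInverse, coe_units_inv, hu] using h_entry

end Matrix

/-- Time derivative of the Bregman divergence with the log-det function
(Lemma 3 of the paper): if `L̂` has entrywise derivative `L̂'` at `t` and
`L̂ t` is symmetric positive definite, then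
`d/dt [log(det L̂ / det L) + tr(L̂⁻¹ L) − 4] = tr((L̂⁻¹ L̂' L̂⁻¹)(L̂ − L))`. -/
theorem bregman_logdet_hasDerivAt
    (L : Matrix (Fin 4) (Fin 4) ℝ) (hL : L.PosDef) (hLsymm : L.IsSymm)
    (Lhat : ℝ → Matrix (Fin 4) (Fin 4) ℝ) (Lhat' : Matrix (Fin 4) (Fin 4) ℝ)
    (t : ℝ)
    (hderiv : ∀ i j, HasDerivAt (fun s => Lhat s i j) (Lhat' i j) t)
    (hpd : (Lhat t).PosDef) (hsymm : (Lhat t).IsSymm) :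
    HasDerivAt
      (fun s => Real.log ((Lhat s).det / L.det) + ((Lhat s)⁻¹ * L).trace - 4)
      ((((Lhat t)⁻¹ * Lhat' * (Lhat t)⁻¹) * (Lhat t - L)).trace) t := by
  have hdet : (Lhat t).det ≠ 0 := hpd.det_pos.ne'
  have hunit : IsUnit (Lhat t) := hpd.isUnit
  have hlog := ((hasDerivAt_det hderiv).div_const L.det).log (div_ne_zero hdet hL.det_pos.ne')
  have htrace : HasDerivAt (fun s => ((Lhat s)⁻¹ * L).trace)
      ((-((Lhat t)⁻¹ * Lhat' * (Lhat t)⁻¹) * L).trace) t := by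
    simp only [trace, diag_apply, mul_apply (N := L)]
    exact HasDerivAt.fun_sum fun i _ => HasDerivAt.fun_sum fun j _ =>
      (hasDerivAt_inv_apply hderiv hunit i j).mul_const _
  have hjacobi : (adjugate (Lhat t) * Lhat').trace / L.det / ((Lhat t).det / L.det) =
      ((Lhat t)⁻¹ * Lhat').trace := by
    rw [div_div_div_cancel_right₀ hL.det_pos.ne', inv_def, smul_mul, trace_smul,
      Ring.inverse_eq_inv', smul_eq_mul, div_eq_inv_mul]
  have hvalue : ((Lhat t)⁻¹ * Lhat' * (Lhat t)⁻¹ * (Lhat t - L)).trace =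
      ((Lhat t)⁻¹ * Lhat').trace + (-((Lhat t)⁻¹ * Lhat' * (Lhat t)⁻¹) * L).trace := by
    rw [mul_sub, trace_sub, neg_mul, trace_neg, ← sub_eq_add_neg,
      nonsing_inv_mul_cancel_right _ _ hdet.isUnit]
  rw [hjacobi] at hlog
  rw [hvalue]
  exact (hlog.add htrace).sub_const 4
end

section
/- Consider the map f sending a triple (m, h, Ī), where m ∈ ℝ, h ∈ ℝ³ (viewed as a 3×1 column), and Ī is a 3×3 real symmetric matrix, to the 4×4 block matrix f(m, h, Ī) = [[ (1/2)·tr(Ī)·I₃ − Ī , h ], [ hᵀ , m ]]. Then f is a linear bijection from ℝ × ℝ³ × {3×3 real symmetric matrices} onto the space of 4×4 real symmetric matrices, and its inverse sends a symmetric block matrix [[S, h],[hᵀ, m]] (with S the 3×3 real symmetric upper-left block) to (m, h, tr(S)·I₃ − S). -/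
open Matrix

lemma trace_half_trace_smul_one_sub (A : Matrix (Fin 3) (Fin 3) ℝ) :
    (((1 : ℝ) / 2 * A.trace) • (1 : Matrix (Fin 3) (Fin 3) ℝ) - A).trace = 1 / 2 * A.trace := by
  rw [trace_sub, trace_smul, trace_one, smul_eq_mul, Fintype.card_fin]
  push_cast
  ring

lemma trace_trace_smul_one_sub (S : Matrix (Fin 3) (Fin 3) ℝ) :
    (S.trace • (1 : Matrix (Fin 3) (Fin 3) ℝ) - S).trace = 2 * S.trace := by
  rw [trace_sub, trace_smul, trace_one, smul_eq_mul, Fintype.card_fin]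
  push_cast
  ring

lemma mem_selfAdjoint_submodule_iff_isSymm {n : Type*} [Fintype n] [DecidableEq n]
    {A : Matrix n n ℝ} : A ∈ selfAdjoint.submodule ℝ (Matrix n n ℝ) ↔ A.IsSymm := by
  change Aᴴ = A ↔ Aᵀ = A
  rw [conjTranspose_eq_transpose_of_trivial]

lemma isSymm_smul_one_sub {n : Type*} [DecidableEq n] {A : Matrix n n ℝ} (hA : A.IsSymm)
    (c : ℝ) : (c • (1 : Matrix n n ℝ) - A).IsSymm :=
  (isSymm_one.smul c).sub hA

/-- The symmetric `4 × 4` matrix attached to mass, first moment and rotational inertia. -/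
noncomputable def pseudoInertia : (ℝ × Matrix (Fin 3) (Fin 1) ℝ ×
      selfAdjoint.submodule ℝ (Matrix (Fin 3) (Fin 3) ℝ)) →ₗ[ℝ]
    selfAdjoint.submodule ℝ (Matrix (Fin 3 ⊕ Fin 1) (Fin 3 ⊕ Fin 1) ℝ) where
  toFun p := ⟨fromBlocks
      (((1 : ℝ) / 2 * (p.2.2 : Matrix (Fin 3) (Fin 3) ℝ).trace) •
        (1 : Matrix (Fin 3) (Fin 3) ℝ) - (p.2.2 : Matrix (Fin 3) (Fin 3) ℝ))
      p.2.1 p.2.1.transpose (of fun _ _ => p.1),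
    mem_selfAdjoint_submodule_iff_isSymm.2 <| IsSymm.fromBlocks
      (isSymm_smul_one_sub (mem_selfAdjoint_submodule_iff_isSymm.1 p.2.2.2) _) rfl rfl⟩
  map_add' p q := by
    ext (i | i) (j | j) <;> simp <;> ring
  map_smul' c p := by
    ext (i | i) (j | j) <;> simp <;> ring

/-- Mass, first moment and rotational inertia recovered from a symmetric `4 × 4` matrix. -/
noncomputable def inertialParam (M : selfAdjoint.submodule ℝ (Matrix (Fin 3 ⊕ Fin 1) (Fin 3 ⊕ Fin 1) ℝ)) :
    ℝ × Matrix (Fin 3) (Fin 1) ℝ × selfAdjoint.submodule ℝ (Matrix (Fin 3) (Fin 3) ℝ) :=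
  ⟨M.1 (Sum.inr 0) (Sum.inr 0), M.1.toBlocks₁₂,
    ⟨M.1.toBlocks₁₁.trace • (1 : Matrix (Fin 3) (Fin 3) ℝ) - M.1.toBlocks₁₁,
      mem_selfAdjoint_submodule_iff_isSymm.2 <| isSymm_smul_one_sub
        ((mem_selfAdjoint_submodule_iff_isSymm.1 M.2).submatrix Sum.inl) _⟩⟩

lemma inertialParam_pseudoInertia : Function.LeftInverse inertialParam pseudoInertia := by
  rintro ⟨m, h, A⟩
  refine Prod.ext rfl (Prod.ext (toBlocks_fromBlocks₁₂ _ _ _ _) (Subtype.ext ?_))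
  simp only [inertialParam, pseudoInertia, LinearMap.coe_mk, AddHom.coe_mk,
    toBlocks_fromBlocks₁₁, trace_half_trace_smul_one_sub, sub_sub_cancel]

lemma pseudoInertia_inertialParam : Function.RightInverse inertialParam pseudoInertia := by
  rintro ⟨M, hM⟩
  have hs := mem_selfAdjoint_submodule_iff_isSymm.1 hM
  apply Subtype.ext
  simp only [inertialParam, pseudoInertia, LinearMap.coe_mk, AddHom.coe_mk,
    trace_trace_smul_one_sub, one_div, inv_mul_cancel_left₀ (two_ne_zero' ℝ), sub_sub_cancel]
  conv_rhs => rw [← fromBlocks_toBlocks M]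
  congr 1
  · ext i j
    exact hs.apply _ _
  · ext i j
    rw [Subsingleton.elim i 0, Subsingleton.elim j 0]
    rfl

/-- Lemma 2 of the paper: the map
`f (m, h, Ī) = fromBlocks ((1/2)·tr(Ī)·I₃ − Ī) h hᵀ [m]`
is a linear bijection from ℝ × ℝ³ˣ¹ × {3×3 symmetric matrices} onto the
4×4 real symmetric matrices, with inverse
`[[S, h], [hᵀ, m]] ↦ (m, h, tr(S)·I₃ − S)`. -/
theorem inertial_param_linearEquiv :
    ∃ e : (ℝ × Matrix (Fin 3) (Fin 1) ℝ ×
            (selfAdjoint.submodule ℝ (Matrix (Fin 3) (Fin 3) ℝ))) ≃ₗ[ℝ]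
          (selfAdjoint.submodule ℝ (Matrix (Fin 3 ⊕ Fin 1) (Fin 3 ⊕ Fin 1) ℝ)),
      (∀ (m : ℝ) (h : Matrix (Fin 3) (Fin 1) ℝ)
          (I : selfAdjoint.submodule ℝ (Matrix (Fin 3) (Fin 3) ℝ)),
        (e (m, h, I) : Matrix (Fin 3 ⊕ Fin 1) (Fin 3 ⊕ Fin 1) ℝ) =
          Matrix.fromBlocks
            (((1 : ℝ)/2 * (I : Matrix (Fin 3) (Fin 3) ℝ).trace) •
                (1 : Matrix (Fin 3) (Fin 3) ℝ) - (I : Matrix (Fin 3) (Fin 3) ℝ))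
            h h.transpose (Matrix.of fun _ _ => m)) ∧
      (∀ M : selfAdjoint.submodule ℝ (Matrix (Fin 3 ⊕ Fin 1) (Fin 3 ⊕ Fin 1) ℝ),
        (e.symm M).1 = (M : Matrix (Fin 3 ⊕ Fin 1) (Fin 3 ⊕ Fin 1) ℝ) (Sum.inr 0) (Sum.inr 0) ∧
        (e.symm M).2.1 = (M : Matrix (Fin 3 ⊕ Fin 1) (Fin 3 ⊕ Fin 1) ℝ).toBlocks₁₂ ∧
        ((e.symm M).2.2 : Matrix (Fin 3) (Fin 3) ℝ) =
          ((M : Matrix (Fin 3 ⊕ Fin 1) (Fin 3 ⊕ Fin 1) ℝ).toBlocks₁₁).trace •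
              (1 : Matrix (Fin 3) (Fin 3) ℝ) -
            (M : Matrix (Fin 3 ⊕ Fin 1) (Fin 3 ⊕ Fin 1) ℝ).toBlocks₁₁) := by
  exact ⟨{ pseudoInertia with
      invFun := inertialParam
      left_inv := inertialParam_pseudoInertia
      right_inv := pseudoInertia_inertialParam },
    fun _ _ _ => rfl, fun _ => ⟨rfl, rfl, rfl⟩⟩
end

section
/- Let L > 0, L₁ > 0, x₀ ∈ ℝ, and let x ∈ ℝ be such that u := x + x₀ > 0 and −1 < g₂(x) < 1, where g₂(x) = ( u² + L₁² − L² ) / ( 2·u·L₁ ). Define q₂(x) = −arccos( g₂(x) ) (note that (L² − (x+x₀)² − L₁²)/(−2(x+x₀)L₁) = g₂(x)). Then q₂ is differentiable at x with derivative q₂′(x) = −( (x + x₀) − L₁·cos(q₂(x)) ) / ( (x + x₀)·L₁·sin(q₂(x)) ). -/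
/-- Derivative of the cosine of the angle opposite the side `c` in a triangle with sides
`a`, `b`, `c`, as a function of the side `a`. -/
theorem hasDerivAt_law_of_cosines {a b : ℝ} (c : ℝ) (ha : a ≠ 0) (hb : b ≠ 0) :
    HasDerivAt (fun t : ℝ => (t ^ 2 + b ^ 2 - c ^ 2) / (2 * t * b))
      ((a - b * ((a ^ 2 + b ^ 2 - c ^ 2) / (2 * a * b))) / (a * b)) a := by
  have hnum : HasDerivAt (fun t : ℝ => t ^ 2 + b ^ 2 - c ^ 2) (2 * a) a := by
    simpa using ((hasDerivAt_pow 2 a).add_const (b ^ 2)).sub_const (c ^ 2)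
  have hden : HasDerivAt (fun t : ℝ => 2 * t * b) (2 * b) a := by
    simpa using ((hasDerivAt_id a).const_mul 2).mul_const b
  refine (hnum.div hden (by positivity)).congr_deriv ?_
  field_simp

/-- Derivative of the passive joint angle `q₂(x) = −arccos(g₂(x))` with
`g₂(x) = ((x+x₀)² + L₁² − L²)/(2 (x+x₀) L₁)` (equations (16) and (19) of the
paper): `q₂'(x) = −((x+x₀) − L₁ cos q₂(x)) / ((x+x₀) L₁ sin q₂(x))`. -/
theorem hasDerivAt_passive_joint_angle_q2
    (L L₁ x₀ x : ℝ) (hL : 0 < L) (hL₁ : 0 < L₁)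
    (hu : 0 < x + x₀)
    (hg₁ : -1 < ((x + x₀) ^ 2 + L₁ ^ 2 - L ^ 2) / (2 * (x + x₀) * L₁))
    (hg₂ : ((x + x₀) ^ 2 + L₁ ^ 2 - L ^ 2) / (2 * (x + x₀) * L₁) < 1) :
    HasDerivAt
      (fun y => -Real.arccos (((y + x₀) ^ 2 + L₁ ^ 2 - L ^ 2) / (2 * (y + x₀) * L₁)))
      (-(((x + x₀) - L₁ * Real.cos
            (-Real.arccos (((x + x₀) ^ 2 + L₁ ^ 2 - L ^ 2) / (2 * (x + x₀) * L₁)))) /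
          ((x + x₀) * L₁ * Real.sin
            (-Real.arccos (((x + x₀) ^ 2 + L₁ ^ 2 - L ^ 2) / (2 * (x + x₀) * L₁)))))) x := by
  have hg := (hasDerivAt_law_of_cosines L hu.ne' hL₁.ne').comp_add_const x x₀
  have hq := ((Real.hasDerivAt_arccos hg₁.ne' hg₂.ne).comp x hg).neg
  rw [Real.cos_neg, Real.sin_neg, Real.cos_arccos hg₁.le hg₂.le, Real.sin_arccos]
  refine hq.congr_deriv ?_
  rw [mul_neg, div_neg, neg_neg, neg_mul, neg_neg, one_div_mul_eq_div, div_div]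
end
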